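/- Let E be a finite-dimensional real inner product space. Let f : E → ℝ be twice continuously differentiable and suppose there are constants M₁, M₂ ≥ 0 with ‖∇f(x)‖² ≤ M₁ and |Δf(x)| ≤ M₂ for all x ∈ E. Let R : E → ℝ be a function and r > 0 a constant with R(x) ≥ r for all x ∈ E. Then there exists a constant B > 0 such that for all x ∈ E, −Δ(e^{−Bf})(x) + R(x)·e^{−B·f(x)} ≥ (r/2)·e^{−B·f(x)}. -/

import Mathlib

open RealInnerProductSpace

/-- The Laplacian of a function on a finite-dimensional real inner product space:
the sum of the pure second directional derivatives along an orthonormal basis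
(the trace of the Hessian). -/
noncomputable def laplacian {E : Type*} [NormedAddCommGroup E] [InnerProductSpace ℝ E]
    [FiniteDimensional ℝ E] (f : E → ℝ) (x : E) : ℝ :=
  ∑ i, iteratedFDeriv ℝ 2 f x
    ![(stdOrthonormalBasis ℝ E) i, (stdOrthonormalBasis ℝ E) i]

/-- The second directional derivative of `exp (c * f)` along `v`. -/
theorem iteratedFDeriv_two_exp_mul {E : Type*} [NormedAddCommGroup E] [NormedSpace ℝ E]
    {f : E → ℝ} (hf : ContDiff ℝ 2 f) (c : ℝ) (x v : E) :
    iteratedFDeriv ℝ 2 (fun y => Real.exp (c * f y)) x ![v, v] =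
      Real.exp (c * f x) * (c ^ 2 * fderiv ℝ f x v ^ 2 + c * iteratedFDeriv ℝ 2 f x ![v, v]) := by
  have hd : Differentiable ℝ f := hf.differentiable (by norm_num)
  have hd' : Differentiable ℝ (fderiv ℝ f) :=
    (hf.fderiv_right (m := 1) (by norm_num)).differentiable (by norm_num)
  have hexp (y : E) : HasFDerivAt (fun y => Real.exp (c * f y))
      (Real.exp (c * f y) • c • fderiv ℝ f y) y :=
    ((hd y).hasFDerivAt.const_mul c).exp
  have hfderiv : fderiv ℝ (fun y => Real.exp (c * f y)) =
      fun y => Real.exp (c * f y) • c • fderiv ℝ f y :=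
    funext fun y => (hexp y).fderiv
  have hsecond : HasFDerivAt (fun y => Real.exp (c * f y) • c • fderiv ℝ f y) _ x :=
    (hexp x).smul ((hd' x).hasFDerivAt.const_smul c)
  simp only [iteratedFDeriv_two_apply, hfderiv, hsecond.fderiv]
  simp
  ring

/-- The Laplacian of `exp (c * f)`. -/
theorem laplacian_exp_mul {E : Type*} [NormedAddCommGroup E] [InnerProductSpace ℝ E]
    [FiniteDimensional ℝ E] {f : E → ℝ} (hf : ContDiff ℝ 2 f) (c : ℝ) (x : E) :
    laplacian (fun y => Real.exp (c * f y)) x =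
      Real.exp (c * f x) * (c ^ 2 * ‖gradient f x‖ ^ 2 + c * laplacian f x) := by
  simp only [laplacian, iteratedFDeriv_two_exp_mul hf, ← Finset.mul_sum, Finset.sum_add_distrib,
    ← (stdOrthonormalBasis ℝ E).sum_sq_inner_left (gradient f x), inner_gradient_left]

/-- If `f` is C² with uniformly bounded `‖∇f‖²` and `|Δf|`, and the potential `R` is
bounded below by `r > 0`, then for sufficiently small `B > 0` the function `e^{-Bf}`
satisfies `-Δ(e^{-Bf}) + R e^{-Bf} ≥ (r/2) e^{-Bf}` everywhere. -/
theorem exists_exp_supersolution {E : Type*} [NormedAddCommGroup E] [InnerProductSpace ℝ E]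
    [FiniteDimensional ℝ E] (f : E → ℝ) (hf : ContDiff ℝ 2 f)
    (M₁ M₂ : ℝ) (hM₁ : 0 ≤ M₁) (hM₂ : 0 ≤ M₂)
    (hgrad : ∀ x : E, ‖gradient f x‖ ^ 2 ≤ M₁)
    (hlap : ∀ x : E, |laplacian f x| ≤ M₂)
    (R : E → ℝ) (r : ℝ) (hr : 0 < r) (hR : ∀ x : E, r ≤ R x) :
    ∃ B : ℝ, 0 < B ∧ ∀ x : E,
      -laplacian (fun y => Real.exp (-B * f y)) x + R x * Real.exp (-B * f x)
        ≥ (r / 2) * Real.exp (-B * f x) := by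
  have hD : 0 < 2 * (M₁ + M₂) + r := by positivity
  obtain ⟨B, hB⟩ : ∃ B, B = r / (2 * (M₁ + M₂) + r) := ⟨_, rfl⟩
  have hB0 : 0 < B := hB ▸ div_pos hr hD
  have hBD : B * (2 * (M₁ + M₂) + r) = r := by rw [hB]; field_simp
  have hB1 : B ≤ 1 := by rw [hB, div_le_one hD]; linarith
  refine ⟨B, hB0, fun x => ?_⟩
  have hquad : B ^ 2 * ‖gradient f x‖ ^ 2 ≤ B * M₁ :=
    mul_le_mul (by nlinarith) (hgrad x) (by positivity) hB0.le
  have hlin : B * -laplacian f x ≤ B * M₂ :=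
    mul_le_mul_of_nonneg_left ((neg_le_abs _).trans (hlap x)) hB0.le
  have hBr : 0 < B * r := mul_pos hB0 hr
  have hcoeff : 0 ≤ R x - r / 2 - (B ^ 2 * ‖gradient f x‖ ^ 2 - B * laplacian f x) := by
    linarith [hR x]
  rw [laplacian_exp_mul hf]
  linarith [mul_nonneg (Real.exp_pos (-B * f x)).le hcoeff]
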